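/- arXiv:1302.0250 — 5 statements merged into one kernel-verified Lean document; each statement's English description precedes it below -/
import Mathlib

section
/- For every α ∈ ℝ, β > 0, μ ∈ ℝ and σ > 0, the set S(α, β, μ, σ) = {θ ∈ ℝ : α + β·θ = Φ((θ − μ)/σ)} is nonempty and finite with at most three elements. -/
open Real MeasureTheory

/-- The standard normal cumulative distribution function
`Φ(z) = (1/√(2π)) ∫_{−∞}^{z} exp(−t²/2) dt`. -/
noncomputable def stdNormalCDF (z : ℝ) : ℝ :=
  (Real.sqrt (2 * Real.pi))⁻¹ * ∫ t in Set.Iic z, Real.exp (-t ^ 2 / 2)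

/-- The equilibrium solution set `S(α, β, μ, σ) = {θ : α + β·θ = Φ((θ − μ)/σ)}`. -/
def S (α β μ σ : ℝ) : Set ℝ :=
  {θ : ℝ | α + β * θ = stdNormalCDF ((θ - μ) / σ)}

lemma integrable_exp_neg_sq_div_two : Integrable (fun t : ℝ => Real.exp (-t ^ 2 / 2)) := by
  convert integrable_exp_neg_mul_sq (b := 1 / 2) (by norm_num) using 3
  ring

lemma integral_exp_neg_sq_div_two :
    ∫ t : ℝ, Real.exp (-t ^ 2 / 2) = Real.sqrt (2 * Real.pi) := by
  convert integral_gaussian (1 / 2) using 3 <;> ring_nf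

lemma stdNormalCDF_nonneg (z : ℝ) : 0 ≤ stdNormalCDF z :=
  mul_nonneg (by positivity) (integral_nonneg fun _ => (Real.exp_pos _).le)

lemma stdNormalCDF_le_one (z : ℝ) : stdNormalCDF z ≤ 1 := by
  have h : ∫ t in Set.Iic z, Real.exp (-t ^ 2 / 2) ≤ Real.sqrt (2 * Real.pi) := by
    rw [← integral_exp_neg_sq_div_two]
    exact setIntegral_le_integral integrable_exp_neg_sq_div_two
      (Filter.Eventually.of_forall fun _ => (Real.exp_pos _).le)
  have hpos : 0 < Real.sqrt (2 * Real.pi) := by positivity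
  rw [stdNormalCDF, inv_mul_le_iff₀ hpos, mul_one]
  exact h

lemma hasDerivAt_stdNormalCDF (z : ℝ) :
    HasDerivAt stdNormalCDF ((Real.sqrt (2 * Real.pi))⁻¹ * Real.exp (-z ^ 2 / 2)) z := by
  have hint := integrable_exp_neg_sq_div_two
  have hcont : Continuous fun t : ℝ => Real.exp (-t ^ 2 / 2) := by fun_prop
  have h := (((hcont.integral_hasStrictDerivAt 0 z).hasDerivAt).const_add
    (∫ t in Set.Iic 0, Real.exp (-t ^ 2 / 2))).const_mul (Real.sqrt (2 * Real.pi))⁻¹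
  refine h.congr_of_eventuallyEq (Filter.Eventually.of_forall fun x => ?_)
  simp only [stdNormalCDF]
  rw [← intervalIntegral.integral_Iic_sub_Iic hint.integrableOn hint.integrableOn,
    add_sub_cancel]

lemma hasDerivAt_linear_sub_stdNormalCDF (α β μ σ θ : ℝ) :
    HasDerivAt (fun θ => α + β * θ - stdNormalCDF ((θ - μ) / σ))
      (β - (Real.sqrt (2 * Real.pi))⁻¹ * Real.exp (-((θ - μ) / σ) ^ 2 / 2) * (1 / σ)) θ := by
  have h1 : HasDerivAt (fun θ : ℝ => (θ - μ) / σ) (1 / σ) θ :=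
    ((hasDerivAt_id θ).sub_const μ).div_const σ
  have h2 : HasDerivAt (fun θ : ℝ => α + β * θ) β θ := by
    simpa using ((hasDerivAt_id θ).const_mul β).const_add α
  exact h2.sub ((hasDerivAt_stdNormalCDF _).comp θ h1)

lemma S_nonempty (α β μ σ : ℝ) (hβ : 0 < β) : (S α β μ σ).Nonempty := by
  have hcont : Continuous fun θ => α + β * θ - stdNormalCDF ((θ - μ) / σ) :=
    continuous_iff_continuousAt.2 fun θ =>
      (hasDerivAt_linear_sub_stdNormalCDF α β μ σ θ).continuousAt
  have hlow : α + β * (-α / β) - stdNormalCDF ((-α / β - μ) / σ) ≤ 0 := by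
    rw [mul_div_cancel₀ _ hβ.ne']
    linarith [stdNormalCDF_nonneg ((-α / β - μ) / σ)]
  have hhigh : 0 ≤ α + β * ((1 - α) / β) - stdNormalCDF (((1 - α) / β - μ) / σ) := by
    rw [mul_div_cancel₀ _ hβ.ne']
    linarith [stdNormalCDF_le_one (((1 - α) / β - μ) / σ)]
  obtain ⟨θ, hθ⟩ := mem_range_of_exists_le_of_exists_ge hcont ⟨_, hlow⟩ ⟨_, hhigh⟩
  exact ⟨θ, sub_eq_zero.1 hθ⟩

/-- Between two solutions, the normal density attains the slope of the line. -/
lemma exists_density_eq_slope {α β μ σ a b : ℝ} (hab : a < b)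
    (ha : a ∈ S α β μ σ) (hb : b ∈ S α β μ σ) :
    ∃ x ∈ Set.Ioo a b,
      β = (Real.sqrt (2 * Real.pi))⁻¹ * Real.exp (-((x - μ) / σ) ^ 2 / 2) * (1 / σ) := by
  obtain ⟨x, hx, h⟩ := exists_hasDerivAt_eq_zero hab
    (fun θ _ => (hasDerivAt_linear_sub_stdNormalCDF α β μ σ θ).continuousAt.continuousWithinAt)
    ((sub_eq_zero.2 ha).trans (sub_eq_zero.2 hb).symm)
    (fun θ _ => hasDerivAt_linear_sub_stdNormalCDF α β μ σ θ)
  exact ⟨x, hx, sub_eq_zero.1 h⟩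

lemma sq_eq_sq_of_density_eq {μ σ x y : ℝ} (hσ : 0 < σ)
    (h : (Real.sqrt (2 * Real.pi))⁻¹ * Real.exp (-((x - μ) / σ) ^ 2 / 2) * (1 / σ) =
      (Real.sqrt (2 * Real.pi))⁻¹ * Real.exp (-((y - μ) / σ) ^ 2 / 2) * (1 / σ)) :
    (x - μ) ^ 2 = (y - μ) ^ 2 := by
  have hc : (Real.sqrt (2 * Real.pi))⁻¹ ≠ 0 := by positivity
  have hs : 1 / σ ≠ 0 := by positivity
  have h1 := Real.exp_injective (mul_left_cancel₀ hc (mul_right_cancel₀ hs h))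
  have h2 : ((x - μ) / σ) ^ 2 = ((y - μ) / σ) ^ 2 := by linarith
  rw [div_pow, div_pow] at h2
  exact (div_left_inj' (by positivity)).1 h2

lemma not_four_solutions {α β μ σ a b c d : ℝ} (hσ : 0 < σ)
    (hab : a < b) (hbc : b < c) (hcd : c < d) (ha : a ∈ S α β μ σ) (hb : b ∈ S α β μ σ)
    (hc : c ∈ S α β μ σ) (hd : d ∈ S α β μ σ) : False := by
  obtain ⟨x, hx, hx'⟩ := exists_density_eq_slope hab ha hb
  obtain ⟨y, hy, hy'⟩ := exists_density_eq_slope hbc hb hc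
  obtain ⟨z, hz, hz'⟩ := exists_density_eq_slope hcd hc hd
  have hxy : x < y := hx.2.trans hy.1
  have hyz : y < z := hy.2.trans hz.1
  rcases sq_eq_sq_iff_eq_or_eq_neg.1 (sq_eq_sq_of_density_eq hσ (hx'.symm.trans hy')) with h | h <;>
  rcases sq_eq_sq_iff_eq_or_eq_neg.1 (sq_eq_sq_of_density_eq hσ (hy'.symm.trans hz')) with h' | h' <;>
  linarith

lemma S_encard_le_three (α β μ σ : ℝ) (hσ : 0 < σ) : (S α β μ σ).encard ≤ 3 := by
  by_contra! hlt
  have h4 : (4 : ℕ∞) ≤ (S α β μ σ).encard := by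
    simpa [show (3 : ℕ∞) + 1 = 4 from by norm_num] using Order.add_one_le_of_lt hlt
  obtain ⟨t, ht, hcard⟩ := Set.exists_subset_encard_eq h4
  have hfin : t.Finite := Set.finite_of_encard_eq_coe (k := 4) hcard
  lift t to Finset ℝ using hfin
  have hcard' : t.card = 4 := by
    rw [Set.encard_coe_eq_coe_finsetCard] at hcard
    exact_mod_cast hcard
  have hmem : ∀ i, t.orderEmbOfFin hcard' i ∈ S α β μ σ :=
    fun i => ht (t.orderEmbOfFin_mem hcard' i)
  have hlt' : ∀ i j : Fin 4, i < j → t.orderEmbOfFin hcard' i < t.orderEmbOfFin hcard' j :=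
    fun _ _ h => (t.orderEmbOfFin hcard').strictMono h
  exact not_four_solutions hσ (hlt' 0 1 (by decide)) (hlt' 1 2 (by decide))
    (hlt' 2 3 (by decide)) (hmem 0) (hmem 1) (hmem 2) (hmem 3)

/-- For every `α ∈ ℝ`, `β > 0`, `μ ∈ ℝ`, `σ > 0`, the set `S(α, β, μ, σ)` is
nonempty and finite with at most three elements. -/
theorem stmt0 (α β μ σ : ℝ) (hβ : 0 < β) (hσ : 0 < σ) :
    (S α β μ σ).Nonempty ∧ (S α β μ σ).Finite ∧ (S α β μ σ).ncard ≤ 3 := by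
  have hcard := S_encard_le_three α β μ σ hσ
  have hfin : (S α β μ σ).Finite := Set.finite_of_encard_le_coe (k := 3) hcard
  refine ⟨S_nonempty α β μ σ hβ, hfin, ?_⟩
  rw [← hfin.cast_ncard_eq] at hcard
  exact_mod_cast hcard
end

section
/- If β > 1/σ, then for every α ∈ ℝ and μ ∈ ℝ the set S(α, β, μ, σ) has exactly one element, i.e., the equation α + β·θ = Φ((θ − μ)/σ) has a unique real solution θ. -/
open Real MeasureTheory

lemma abs_stdNormalCDF_sub_le (x y : ℝ) :
    |stdNormalCDF x - stdNormalCDF y| ≤ |x - y| := by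
  have hint : Integrable fun t : ℝ ↦ Real.exp (-t ^ 2 / 2) := by
    convert integrable_exp_neg_mul_sq (b := 1 / 2) (by norm_num) using 3
    ring
  have hbound : |∫ t in y..x, Real.exp (-t ^ 2 / 2)| ≤ |x - y| := by
    have h := intervalIntegral.norm_integral_le_of_norm_le_const (a := y) (b := x) (C := 1)
      (f := fun t : ℝ ↦ Real.exp (-t ^ 2 / 2)) fun t _ ↦ by
        rw [Real.norm_eq_abs, Real.abs_exp, Real.exp_le_one_iff]
        nlinarith [sq_nonneg t]
    simpa using h
  have hc : (Real.sqrt (2 * Real.pi))⁻¹ ≤ 1 := by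
    apply inv_le_one_of_one_le₀
    rw [Real.one_le_sqrt]
    linarith [Real.pi_gt_three]
  rw [stdNormalCDF, stdNormalCDF, ← mul_sub,
    intervalIntegral.integral_Iic_sub_Iic hint.integrableOn hint.integrableOn, abs_mul,
    abs_of_nonneg (by positivity)]
  exact (mul_le_of_le_one_left (abs_nonneg _) hc).trans hbound

/-- If `β > 1/σ`, then for every `α` and `μ` the equation
`α + β·θ = Φ((θ − μ)/σ)` has a unique real solution (Lemma A.1(i)). -/
theorem stmt2 (β σ : ℝ) (hσ : 0 < σ) (hβ : β > 1 / σ) :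
    ∀ (α μ : ℝ), ∃! θ : ℝ, θ ∈ S α β μ σ := by
  intro α μ
  have hβ₀ : 0 < β := (one_div_pos.mpr hσ).trans hβ
  have hβσ : 1 < β * σ := (div_lt_iff₀ hσ).mp hβ
  let K : NNReal := ⟨1 / (β * σ), by positivity⟩
  let f : ℝ → ℝ := fun θ ↦ (stdNormalCDF ((θ - μ) / σ) - α) / β
  have hf : ContractingWith K f := by
    refine ⟨?_, LipschitzWith.of_dist_le_mul fun x y ↦ ?_⟩
    · rw [← NNReal.coe_lt_coe]
      exact (div_lt_one (by positivity)).mpr hβσ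
    · have h := abs_stdNormalCDF_sub_le ((x - μ) / σ) ((y - μ) / σ)
      rw [← sub_div, sub_sub_sub_cancel_right, abs_div, abs_of_pos hσ] at h
      change |f x - f y| ≤ 1 / (β * σ) * |x - y|
      simp only [f]
      rw [← sub_div, sub_sub_sub_cancel_right, abs_div, abs_of_pos hβ₀]
      calc _ ≤ |x - y| / σ / β := by gcongr
        _ = _ := by field_simp
  have hmem (θ : ℝ) : θ ∈ S α β μ σ ↔ Function.IsFixedPt f θ := by
    change α + β * θ = _ ↔ (_ - α) / β = θ
    rw [div_eq_iff hβ₀.ne']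
    constructor <;> intro h <;> linarith
  exact ⟨ContractingWith.fixedPoint f hf, (hmem _).mpr hf.fixedPoint_isFixedPt,
    fun θ hθ ↦ hf.fixedPoint_unique ((hmem θ).mp hθ)⟩
end

section
/- Fix τ₀ > 0 and τ_θ > 0, and for τ_e ≥ 0 define σ²_RHS(τ_e) := (τ₀ + τ_e + τ_θ)·(τ₀ + τ_e + 2τ_θ) / (τ_θ·(τ₀ + τ_e)²). Then the function τ_e ↦ σ²_RHS(τ_e) is strictly decreasing on [0, ∞), and σ²_RHS(τ_e) tends to 1/τ_θ as τ_e → ∞. -/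
open Real Filter

/-- The variance is a quadratic polynomial in the inverse of the public precision `s`. -/
theorem variance_eq_quadratic_inv {s t : ℝ} (ht : t ≠ 0) (hs : s ≠ 0) :
    (s + t) * (s + 2 * t) / (t * s ^ 2) = 1 / t + 3 * s⁻¹ + 2 * t * s⁻¹ ^ 2 := by
  field_simp
  ring

/-- For fixed `τ₀ > 0`, `τ_θ > 0`, the variance
`σ²_RHS(τ_e) = (τ₀ + τ_e + τ_θ)(τ₀ + τ_e + 2τ_θ)/(τ_θ(τ₀ + τ_e)²)` is strictly
decreasing in the election precision `τ_e` on `[0, ∞)`, and tends to `1/τ_θ`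
as `τ_e → ∞`. -/
theorem stmt6 (τ0 τθ : ℝ) (h0 : 0 < τ0) (hθ : 0 < τθ) :
    StrictAntiOn
      (fun τe : ℝ => (τ0 + τe + τθ) * (τ0 + τe + 2 * τθ) / (τθ * (τ0 + τe) ^ 2))
      (Set.Ici 0) ∧
    Tendsto
      (fun τe : ℝ => (τ0 + τe + τθ) * (τ0 + τe + 2 * τθ) / (τθ * (τ0 + τe) ^ 2))
      atTop (nhds (1 / τθ)) := by
  constructor
  · intro a ha b hb hab
    have ha0 : 0 < τ0 + a := add_pos_of_pos_of_nonneg h0 ha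
    have hb0 : 0 < τ0 + b := add_pos_of_pos_of_nonneg h0 hb
    have hinv : (τ0 + b)⁻¹ < (τ0 + a)⁻¹ := inv_strictAnti₀ ha0 (by linarith)
    simp only [variance_eq_quadratic_inv hθ.ne' ha0.ne', variance_eq_quadratic_inv hθ.ne' hb0.ne']
    gcongr
  · have hu : Tendsto (fun τe : ℝ => (τ0 + τe)⁻¹) atTop (nhds 0) :=
      tendsto_inv_atTop_zero.comp (tendsto_atTop_add_const_left _ _ tendsto_id)
    have hlim : Tendsto
        (fun τe : ℝ => 1 / τθ + 3 * (τ0 + τe)⁻¹ + 2 * τθ * (τ0 + τe)⁻¹ ^ 2)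
        atTop (nhds (1 / τθ)) := by
      simpa using ((hu.const_mul 3).const_add (1 / τθ)).add ((hu.pow 2).const_mul (2 * τθ))
    refine hlim.congr' ?_
    filter_upwards [eventually_ge_atTop 0] with τe hτe
    exact (variance_eq_quadratic_inv hθ.ne' (add_pos_of_pos_of_nonneg h0 hτe).ne').symm
end

section
/- Let b, σ > 0 and μ ∈ ℝ. For c, k₁ > 0 with b·σ·√(2π) > k₁, let θ̂(c, k₁) denote the unique solution of b·θ + c + k₁ = k₁·Φ((θ − μ)/σ). Then θ̂ is strictly decreasing in each cost parameter: (i) if 0 < c₁ < c₂ then θ̂(c₂, k₁) < θ̂(c₁, k₁); (ii) if 0 < k₁ < k₁′ and b·σ·√(2π) > k₁′, then θ̂(c, k₁′) < θ̂(c, k₁). -/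
open Real MeasureTheory

lemma stdNormalCDF_sub (w z : ℝ) :
    stdNormalCDF z - stdNormalCDF w =
      (Real.sqrt (2 * Real.pi))⁻¹ * ∫ t in w..z, Real.exp (-t ^ 2 / 2) := by
  rw [stdNormalCDF, stdNormalCDF, ← mul_sub, intervalIntegral.integral_Iic_sub_Iic
    integrable_exp_neg_sq_div_two.integrableOn integrable_exp_neg_sq_div_two.integrableOn]

lemma stdNormalCDF_strictMono : StrictMono stdNormalCDF := by
  intro w z hwz
  have h := intervalIntegral.intervalIntegral_pos_of_pos
    (integrable_exp_neg_sq_div_two.intervalIntegrable (a := w) (b := z))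
    (fun t => Real.exp_pos _) hwz
  rw [← sub_pos, stdNormalCDF_sub]
  positivity

lemma stdNormalCDF_lt_one (z : ℝ) : stdNormalCDF z < 1 := by
  refine (stdNormalCDF_strictMono (lt_add_one z)).trans_le ?_
  rw [stdNormalCDF, inv_mul_le_iff₀ (by positivity), mul_one, ← integral_exp_neg_sq_div_two]
  exact setIntegral_le_integral integrable_exp_neg_sq_div_two
    (Filter.Eventually.of_forall fun t => (Real.exp_pos _).le)

lemma stdNormalCDF_sub_le {w z : ℝ} (hwz : w ≤ z) :
    stdNormalCDF z - stdNormalCDF w ≤ (Real.sqrt (2 * Real.pi))⁻¹ * (z - w) := by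
  rw [stdNormalCDF_sub]
  gcongr
  have h := intervalIntegral.integral_mono_on hwz
    integrable_exp_neg_sq_div_two.intervalIntegrable
    (intervalIntegrable_const (μ := volume) (c := (1 : ℝ)))
    (fun t _ => Real.exp_le_one_iff.2 (by nlinarith [sq_nonneg t]))
  simpa using h

/-- In the unique-equilibrium case the marginal effect of the threshold on the expected
variable cost is at most its marginal effect `b` on sentiment. -/
lemma mul_stdNormalCDF_sub_le {b σ μ k x y : ℝ} (hσ : 0 < σ) (hk : 0 < k)
    (hu : k < b * σ * Real.sqrt (2 * Real.pi)) (hxy : x ≤ y) :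
    k * (stdNormalCDF ((y - μ) / σ) - stdNormalCDF ((x - μ) / σ)) ≤ b * (y - x) := by
  have hs : 0 < Real.sqrt (2 * Real.pi) := by positivity
  have hz : (x - μ) / σ ≤ (y - μ) / σ := by gcongr
  calc k * (stdNormalCDF ((y - μ) / σ) - stdNormalCDF ((x - μ) / σ))
      ≤ k * ((Real.sqrt (2 * Real.pi))⁻¹ * ((y - μ) / σ - (x - μ) / σ)) := by
        gcongr
        exact stdNormalCDF_sub_le hz
    _ = k / (σ * Real.sqrt (2 * Real.pi)) * (y - x) := by
        field_simp
        ring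
    _ ≤ b * (y - x) := by
        refine mul_le_mul_of_nonneg_right ?_ (sub_nonneg.2 hxy)
        rw [div_le_iff₀ (by positivity)]
        linarith

/-- Proposition 1(i): in the unique-equilibrium case (`b·σ·√(2π) > k₁`), the
equilibrium protest threshold `θ̂(c, k₁)` (the unique solution of
`b·θ + c + k₁ = k₁·Φ((θ − μ)/σ)`) is strictly decreasing in the fixed cost `c`
and in the variable cost parameter `k₁`. -/
theorem stmt9 (b σ μ : ℝ) (hb : 0 < b) (hσ : 0 < σ) :
    (∀ c₁ c₂ k₁ θ₁ θ₂ : ℝ, 0 < c₁ → c₁ < c₂ → 0 < k₁ →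
      b * σ * Real.sqrt (2 * Real.pi) > k₁ →
      b * θ₁ + c₁ + k₁ = k₁ * stdNormalCDF ((θ₁ - μ) / σ) →
      b * θ₂ + c₂ + k₁ = k₁ * stdNormalCDF ((θ₂ - μ) / σ) →
      θ₂ < θ₁) ∧
    (∀ c k₁ k₁' θ θ' : ℝ, 0 < c → 0 < k₁ → k₁ < k₁' →
      b * σ * Real.sqrt (2 * Real.pi) > k₁' →
      b * θ + c + k₁ = k₁ * stdNormalCDF ((θ - μ) / σ) →
      b * θ' + c + k₁' = k₁' * stdNormalCDF ((θ' - μ) / σ) →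
      θ' < θ) := by
  refine ⟨fun c₁ c₂ k₁ θ₁ θ₂ _ hc hk hu h₁ h₂ => ?_,
    fun c k₁ k₁' θ θ' _ hk hkk hu h h' => ?_⟩
  · by_contra! hle
    have hslope := mul_stdNormalCDF_sub_le (μ := μ) hσ hk hu hle
    linarith
  · by_contra! hle
    have hslope := mul_stdNormalCDF_sub_le (μ := μ) hσ (hk.trans hkk) hu hle
    have hlt := mul_pos (sub_pos.2 hkk) (sub_pos.2 (stdNormalCDF_lt_one ((θ - μ) / σ)))
    linarith
end

section
/- Let b, c, k₁, σ > 0 with b·σ·√(2π) > k₁, let θ̂(μ) denote the unique solution of b·θ + c + k₁ = k₁·Φ((θ − μ)/σ), and let κ > 0. Then Φ(κ·(θ̂(μ) − μ)) → 1 as μ → −∞ and Φ(κ·(θ̂(μ) − μ)) → 0 as μ → +∞. -/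
open Real MeasureTheory

/-- The standard normal CDF is the CDF of the standard Gaussian measure on `ℝ`. -/
theorem stdNormalCDF_eq_cdf :
    stdNormalCDF = ProbabilityTheory.cdf (ProbabilityTheory.gaussianReal 0 1) := by
  funext z
  rw [ProbabilityTheory.cdf_eq_real, measureReal_def,
    ProbabilityTheory.gaussianReal_apply_eq_integral _ one_ne_zero, ENNReal.toReal_ofReal
      (integral_nonneg fun x => ProbabilityTheory.gaussianPDFReal_nonneg _ _ x)]
  simp [stdNormalCDF, ProbabilityTheory.gaussianPDFReal, integral_const_mul]

/-- In the unique-equilibrium case (`b·σ·√(2π) > k₁`), with `θ̂(μ)` the unique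
solution of `b·θ + c + k₁ = k₁·Φ((θ − μ)/σ)` and `κ > 0`, the expected protest
level `Φ(κ·(θ̂(μ) − μ))` tends to `1` as `μ → −∞` and to `0` as `μ → +∞`. -/
theorem stmt11 (b c k₁ σ : ℝ) (hb : 0 < b) (hc : 0 < c) (hk : 0 < k₁) (hσ : 0 < σ)
    (hslope : b * σ * Real.sqrt (2 * Real.pi) > k₁)
    (f : ℝ → ℝ)
    (hf : ∀ μ : ℝ, b * f μ + c + k₁ = k₁ * stdNormalCDF ((f μ - μ) / σ))
    (κ : ℝ) (hκ : 0 < κ) :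
    Filter.Tendsto (fun μ : ℝ => stdNormalCDF (κ * (f μ - μ))) Filter.atBot (nhds 1) ∧
    Filter.Tendsto (fun μ : ℝ => stdNormalCDF (κ * (f μ - μ))) Filter.atTop (nhds 0) := by
  rw [stdNormalCDF_eq_cdf] at *
  have lower : ∀ μ, -(c + k₁) / b ≤ f μ := fun μ => by
    rw [div_le_iff₀ hb]
    nlinarith [hf μ, mul_nonneg hk.le (ProbabilityTheory.cdf_nonneg
      (ProbabilityTheory.gaussianReal 0 1) ((f μ - μ) / σ))]
  have upper : ∀ μ, f μ ≤ -c / b := fun μ => by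
    rw [le_div_iff₀ hb]
    nlinarith [hf μ, mul_le_mul_of_nonneg_left (ProbabilityTheory.cdf_le_one
      (ProbabilityTheory.gaussianReal 0 1) ((f μ - μ) / σ)) hk.le]
  constructor
  · refine (ProbabilityTheory.tendsto_cdf_atTop _).comp (Filter.Tendsto.const_mul_atTop hκ ?_)
    simp only [sub_eq_add_neg]
    exact Filter.tendsto_atTop_add_left_of_le _ _ lower Filter.tendsto_neg_atBot_atTop
  · refine (ProbabilityTheory.tendsto_cdf_atBot _).comp (Filter.Tendsto.const_mul_atBot hκ ?_)
    simp only [sub_eq_add_neg]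
    exact Filter.tendsto_atBot_add_left_of_ge _ _ upper Filter.tendsto_neg_atTop_atBot
end
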